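/- arXiv:1810.05949 — 6 statements merged into one kernel-verified Lean document; each statement's English description precedes it below -/
import Mathlib

section
/- Let ε > 0 and N > 0, and set γ⁺ = (ε² + √(ε⁴ + 2ε²N))/N. Then N·(ln(1+γ⁺) − γ⁺/(1+γ⁺)) < 2ε²; in particular, any SINR value γ_w with 0 < γ_w ≤ γ⁺ satisfies the covertness constraint N·(ln(1+γ_w) − γ_w/(1+γ_w)) ≤ 2ε². -/
/-- The bound `log (1 + x) - x / (1 + x) < x ^ 2 / (1 + x)` for positive `x`. -/
theorem log_one_add_sub_div_lt {x : ℝ} (hx : 0 < x) :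
    Real.log (1 + x) - x / (1 + x) < x ^ 2 / (1 + x) := by
  have h := Real.log_lt_sub_one_of_pos (show 0 < 1 + x by linarith) (by linarith)
  have e : x ^ 2 / (1 + x) + x / (1 + x) = x := by
    field_simp
    ring
  linarith

/-- Below the positive root `p` of `N * x ^ 2 = c * (1 + x)`, one has
`N * (log (1 + x) - x / (1 + x)) < c`. -/
theorem mul_log_one_add_sub_div_lt {N c p x : ℝ} (hN : 0 < N) (hc : 0 < c) (hp : 0 < p)
    (hroot : N * p ^ 2 = c * (1 + p)) (hx : 0 < x) (hxp : x ≤ p) :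
    N * (Real.log (1 + x) - x / (1 + x)) < c := by
  have hpos : 0 < N * p - c := by
    have : 0 < p * (N * p - c) := by linarith [show p * (N * p - c) = c by linear_combination hroot]
    exact pos_of_mul_pos_right this hp.le
  have h₁ : x * (N * x) ≤ x * (N * p) := by gcongr
  have h₂ : x * (N * p - c) ≤ p * (N * p - c) := by gcongr
  have h₃ : N * (x ^ 2 / (1 + x)) ≤ c := by
    rw [← mul_div_assoc, div_le_iff₀ (by linarith)]
    linarith
  exact (mul_lt_mul_of_pos_left (log_one_add_sub_div_lt hx) hN).trans_le h₃

/-- With γ⁺ = (ε² + √(ε⁴ + 2ε²N))/N (ε > 0, N > 0), one has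
N·(ln(1+γ⁺) − γ⁺/(1+γ⁺)) < 2ε², and every γ_w with 0 < γ_w ≤ γ⁺ satisfies
N·(ln(1+γ_w) − γ_w/(1+γ_w)) ≤ 2ε². -/
theorem stmt_2 (ε N : ℝ) (hε : ε > 0) (hN : N > 0) :
    let γp : ℝ := (ε ^ 2 + Real.sqrt (ε ^ 4 + 2 * ε ^ 2 * N)) / N
    N * (Real.log (1 + γp) - γp / (1 + γp)) < 2 * ε ^ 2 ∧
    ∀ γw : ℝ, 0 < γw → γw ≤ γp →
      N * (Real.log (1 + γw) - γw / (1 + γw)) ≤ 2 * ε ^ 2 := by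
  intro γp
  have hs := Real.sq_sqrt (show 0 ≤ ε ^ 4 + 2 * ε ^ 2 * N by positivity)
  have hp : 0 < γp := by positivity
  have hroot : N * γp ^ 2 = 2 * ε ^ 2 * (1 + γp) := by
    simp only [γp]
    generalize √(ε ^ 4 + 2 * ε ^ 2 * N) = s at hs ⊢
    field_simp
    linear_combination hs
  have key := fun x => mul_log_one_add_sub_div_lt (x := x) hN (by positivity) hp hroot
  exact ⟨key γp hp le_rfl, fun γw hw hle => (key γw hw hle).le⟩
end

section
/- Let ε > 0, N > 0, σ_w² > 0, P_b^max ≥ 0, and set γ⁺ = (ε² + √(ε⁴ + 2ε²N))/N and P_a^u = (P_b^max + σ_w²)·γ⁺. If 0 < P_a ≤ P_a^u, then taking P_b = P_b^max yields γ_w = P_a/(σ_w² + P_b^max) ≤ γ⁺ and hence N·(ln(1+γ_w) − γ_w/(1+γ_w)) < 2ε², i.e., the covertness constraint is satisfiable (the feasibility condition of problem P1 holds). -/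
/-- A nonnegative number below the larger root of `N x² = 2 a x + 2 a` satisfies
`N x² ≤ 2 a (1 + x)`. -/
theorem mul_sq_le_of_le_root {a N x : ℝ} (ha : 0 ≤ a) (hN : 0 < N) (hx : 0 ≤ x)
    (h : x ≤ (a + Real.sqrt (a ^ 2 + 2 * a * N)) / N) :
    N * x ^ 2 ≤ 2 * a * (1 + x) := by
  have hNx := mul_nonneg hN.le hx
  have haN := mul_nonneg ha hN.le
  rw [le_div_iff₀ hN] at h
  have hs : a ≤ Real.sqrt (a ^ 2 + 2 * a * N) := Real.le_sqrt_of_sq_le (by linarith)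
  have hsq : (N * x - a) ^ 2 ≤ a ^ 2 + 2 * a * N := by
    rw [← Real.sqrt_le_sqrt_iff (by positivity), Real.sqrt_sq_eq_abs, abs_le]
    constructor <;> linarith
  refine le_of_mul_le_mul_left ?_ hN
  linarith


/-- With γ⁺ = (ε² + √(ε⁴ + 2ε²N))/N and P_a^u = (P_b^max + σ_w²)·γ⁺,
if 0 < P_a ≤ P_a^u then γ_w = P_a/(σ_w² + P_b^max) ≤ γ⁺ and
N·(ln(1+γ_w) − γ_w/(1+γ_w)) < 2ε². -/
theorem stmt_6 (ε N σw2 Pbmax Pa : ℝ) (hε : ε > 0) (hN : N > 0) (hσ : σw2 > 0)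
    (hPbmax : Pbmax ≥ 0) (hPa : 0 < Pa)
    (hPau : Pa ≤ (Pbmax + σw2) * ((ε ^ 2 + Real.sqrt (ε ^ 4 + 2 * ε ^ 2 * N)) / N)) :
    let γp : ℝ := (ε ^ 2 + Real.sqrt (ε ^ 4 + 2 * ε ^ 2 * N)) / N
    let γw : ℝ := Pa / (σw2 + Pbmax)
    γw ≤ γp ∧ N * (Real.log (1 + γw) - γw / (1 + γw)) < 2 * ε ^ 2 := by
  intro γp γw
  have hS : 0 < σw2 + Pbmax := by linarith
  have hγ : γw ≤ γp := by
    rw [div_le_iff₀ hS]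
    linarith
  have hpos : 0 < γw := div_pos hPa hS
  refine ⟨hγ, ?_⟩
  have hquad : N * γw ^ 2 ≤ 2 * ε ^ 2 * (1 + γw) :=
    mul_sq_le_of_le_root (sq_nonneg ε) hN hpos.le (by
      rw [show (ε ^ 2) ^ 2 = ε ^ 4 by ring]
      exact hγ)
  calc N * (Real.log (1 + γw) - γw / (1 + γw))
      < N * (γw ^ 2 / (1 + γw)) := mul_lt_mul_of_pos_left (log_one_add_sub_div_lt hpos) hN
    _ = N * γw ^ 2 / (1 + γw) := by ring
    _ ≤ 2 * ε ^ 2 := by rwa [div_le_iff₀ (by linarith)]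
end

section
/- Let ε > 0, N > 0, σ_w² > 0, and suppose P_a > σ_w²·(ε² + √(ε⁴ + 2ε²N))/N. Then P_b* = P_a·N/(ε² + √(ε⁴ + 2ε²N)) − σ_w² is strictly positive, and transmitting artificial noise with power P_b = P_b* yields N·(ln(1+γ_w) − γ_w/(1+γ_w)) < 2ε² where γ_w = P_a/(σ_w² + P_b*); i.e., the power choice of Theorem 1 rigorously satisfies the covertness constraint. -/
/-- If P_a > σ_w²·(ε² + √(ε⁴ + 2ε²N))/N (ε > 0, N > 0, σ_w² > 0), then
P_b* = P_a·N/(ε² + √(ε⁴ + 2ε²N)) − σ_w² > 0, and with γ_w = P_a/(σ_w² + P_b*) the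
covertness constraint holds strictly: N·(ln(1+γ_w) − γ_w/(1+γ_w)) < 2ε². -/
theorem stmt_8 (ε N σw2 Pa : ℝ) (hε : ε > 0) (hN : N > 0) (hσ : σw2 > 0)
    (hPa : Pa > σw2 * ((ε ^ 2 + Real.sqrt (ε ^ 4 + 2 * ε ^ 2 * N)) / N)) :
    let Pbs : ℝ := Pa * N / (ε ^ 2 + Real.sqrt (ε ^ 4 + 2 * ε ^ 2 * N)) - σw2
    let γw : ℝ := Pa / (σw2 + Pbs)
    Pbs > 0 ∧ N * (Real.log (1 + γw) - γw / (1 + γw)) < 2 * ε ^ 2 := by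
  intro Pbs γw
  set A : ℝ := ε ^ 2 + Real.sqrt (ε ^ 4 + 2 * ε ^ 2 * N) with hA
  have hA_pos : 0 < A := by positivity
  have hsqrt : Real.sqrt (ε ^ 4 + 2 * ε ^ 2 * N) ^ 2 = ε ^ 4 + 2 * ε ^ 2 * N :=
    Real.sq_sqrt (by positivity)
  have hquad : A ^ 2 = 2 * ε ^ 2 * (N + A) := by
    rw [hA]
    linear_combination hsqrt
  have hPa_pos : 0 < Pa := lt_trans (by positivity) hPa
  have hγ : γw = A / N := by
    change Pa / (σw2 + (Pa * N / A - σw2)) = A / N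
    rw [add_sub_cancel]
    field_simp
  refine ⟨?_, ?_⟩
  · have h : σw2 * A < Pa * N := by
      rwa [gt_iff_lt, ← mul_div_assoc, div_lt_iff₀ hN] at hPa
    exact sub_pos.mpr ((lt_div_iff₀ hA_pos).mpr h)
  · have hγ_pos : 0 < γw := hγ ▸ div_pos hA_pos hN
    have hlog : Real.log (1 + γw) < γw := by
      linarith [Real.log_lt_sub_one_of_pos (by linarith : 0 < 1 + γw) (by linarith)]
    have hε_eq : 2 * ε ^ 2 = N * (γw - γw / (1 + γw)) := by
      rw [hγ]
      field_simp
      linear_combination -hquad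
    rw [hε_eq]
    gcongr
end

section
/- For every real x > 0, x² + 2x − ln(1+x) > 0. Consequently, if R·ln 2 ≥ (1/2)·ln N, then the function ζ(γ) = √N·(1+γ)·(ln(1+γ) + (1/2)ln N − R·ln 2)/√(γ(γ+2)) is strictly increasing on (0,∞). -/
theorem sq_add_two_mul_sub_log_one_add_pos {x : ℝ} (hx : 0 < x) :
    0 < x ^ 2 + 2 * x - Real.log (1 + x) := by
  have := Real.log_le_sub_one_of_pos (show 0 < 1 + x by linarith)
  nlinarith [sq_nonneg x]

theorem hasDerivAt_mul_one_add_mul_log_div_sqrt (a b c : ℝ) {x : ℝ} (hx : 0 < x) :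
    HasDerivAt
      (fun γ : ℝ => a * (1 + γ) * (Real.log (1 + γ) + b - c) / Real.sqrt (γ * (γ + 2)))
      (a * (x ^ 2 + 2 * x - Real.log (1 + x) - b + c) / Real.sqrt (x * (x + 2)) ^ 3) x := by
  have hq : 0 < x * (x + 2) := by positivity
  have hs : 0 < Real.sqrt (x * (x + 2)) := Real.sqrt_pos.2 hq
  have hx1 : 1 + x ≠ 0 := by positivity
  have h1 : HasDerivAt (fun γ : ℝ => 1 + γ) 1 x := (hasDerivAt_id x).const_add 1
  have hL := ((h1.log hx1).add_const b).sub_const c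
  have hq' := (((hasDerivAt_id x).mul ((hasDerivAt_id x).add_const 2))).sqrt hq.ne'
  refine (((h1.const_mul a).mul hL).div hq' hs.ne').congr_deriv ?_
  have h2 : Real.sqrt (x * (x + 2)) ^ 2 = x * (x + 2) := Real.sq_sqrt hq.le
  simp only [id, Pi.mul_apply]
  generalize Real.sqrt (x * (x + 2)) = s at *
  field_simp
  rw [h2]
  ring

/-- For every x > 0, x² + 2x − ln(1+x) > 0; consequently if
R·ln 2 ≥ (1/2)·ln N then ζ(γ) = √N·(1+γ)·(ln(1+γ) + (1/2)ln N − R·ln 2)/√(γ(γ+2))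
is strictly increasing on (0,∞). -/
theorem stmt_10 (N R : ℝ) (hN : N > 0) (hR : R > 0) :
    (∀ x : ℝ, x > 0 → x ^ 2 + 2 * x - Real.log (1 + x) > 0) ∧
    (R * Real.log 2 ≥ (1 / 2) * Real.log N →
      StrictMonoOn
        (fun γ : ℝ =>
          Real.sqrt N * (1 + γ) *
              (Real.log (1 + γ) + (1 / 2) * Real.log N - R * Real.log 2) /
            Real.sqrt (γ * (γ + 2)))
        (Set.Ioi 0)) := by
  refine ⟨fun x hx => sq_add_two_mul_sub_log_one_add_pos hx, fun h => ?_⟩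
  have hd := fun x (hx : x ∈ Set.Ioi (0 : ℝ)) =>
    hasDerivAt_mul_one_add_mul_log_div_sqrt (Real.sqrt N) ((1 / 2) * Real.log N)
      (R * Real.log 2) (Set.mem_Ioi.1 hx)
  refine strictMonoOn_of_deriv_pos (convex_Ioi 0)
    (fun x hx => (hd x hx).continuousAt.continuousWithinAt) fun x hx => ?_
  rw [interior_Ioi] at hx
  rw [(hd x hx).deriv]
  have hx0 : 0 < x := hx
  have hpos := sq_add_two_mul_sub_log_one_add_pos hx0
  have hs : 0 < Real.sqrt (x * (x + 2)) := Real.sqrt_pos.2 (by positivity)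
  exact div_pos (mul_pos (Real.sqrt_pos.2 hN) (by linarith)) (pow_pos hs 3)
end

section
/- Let N > 0 and R > 0 with R·ln 2 ≥ (1/2)·ln N, and let Q(x) denote the complementary CDF of a standard real Gaussian, Q(x) = P(Z > x) for Z ~ N(0,1). Then the decoding error probability γ ↦ δ(γ) = Q(ζ(γ)), with ζ(γ) = √N·(1+γ)·(ln(1+γ) + (1/2)ln N − R·ln 2)/√(γ(γ+2)), is strictly decreasing on (0,∞); equivalently the effective throughput η(γ) = N·R·(1 − δ(γ)) is strictly increasing in the SINR γ. -/
open ProbabilityTheory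

/-- The Gaussian Q-function: complementary CDF of a standard real Gaussian. -/
noncomputable def gaussQ (x : ℝ) : ℝ := (gaussianReal 0 1 (Set.Ioi x)).toReal

/-- The Gaussian Q-function is strictly decreasing. -/
lemma gaussQ_strictAnti : StrictAnti gaussQ := by
  intro a b hab
  have hpos : 0 < gaussianReal 0 1 (Set.Ioc a b) := by
    refine pos_iff_ne_zero.mpr fun h => ?_
    have h' := gaussianReal_absolutelyContinuous' 0 one_ne_zero h
    rw [Real.volume_Ioc, ENNReal.ofReal_eq_zero] at h'
    linarith
  unfold gaussQ
  rw [← Set.Ioc_union_Ioi_eq_Ioi hab.le,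
    MeasureTheory.measure_union (Set.Ioc_disjoint_Ioi le_rfl) measurableSet_Ioi,
    ENNReal.toReal_add (MeasureTheory.measure_ne_top _ _) (MeasureTheory.measure_ne_top _ _)]
  linarith [ENNReal.toReal_pos hpos.ne' (MeasureTheory.measure_ne_top _ _)]

lemma strictMonoOn_mul_log_sub_div_sqrt {c : ℝ} (hc : 0 ≤ c) :
    StrictMonoOn (fun x : ℝ => (1 + x) * (Real.log (1 + x) - c) / Real.sqrt (x * (x + 2)))
      (Set.Ioi 0) := by
  have hderiv : ∀ x : ℝ, 0 < x → ∃ d > 0, HasDerivAt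
      (fun x : ℝ => (1 + x) * (Real.log (1 + x) - c) / Real.sqrt (x * (x + 2))) d x := by
    intro x hx
    have hs : 0 < Real.sqrt (x * (x + 2)) := Real.sqrt_pos.mpr (by positivity)
    have hsq : Real.sqrt (x * (x + 2)) ^ 2 = x * (x + 2) := Real.sq_sqrt (by positivity)
    have h1 : HasDerivAt (fun x : ℝ => 1 + x) 1 x := (hasDerivAt_id x).const_add 1
    have hnum := h1.mul ((h1.log (by positivity)).sub_const c)
    have hden := ((hasDerivAt_id x).mul ((hasDerivAt_id x).add_const 2)).sqrt
      (ne_of_gt (by simp only [Pi.mul_apply, id]; positivity))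
    refine ⟨_, ?_, hnum.div hden hs.ne'⟩
    simp only [Pi.mul_apply, id]
    apply div_pos _ (by positivity)
    have hlog : Real.log (1 + x) ≤ x := by
      linarith [Real.log_le_sub_one_of_pos (show 0 < 1 + x by linarith)]
    set s := Real.sqrt (x * (x + 2))
    set L := Real.log (1 + x)
    have hx1 : 1 + x ≠ 0 := by positivity
    have key : (1 * (L - c) + (1 + x) * (1 / (1 + x))) * s -
        (1 + x) * (L - c) * ((1 * (x + 2) + x * 1) / (2 * s)) =
        (x * (x + 2) - (L - c)) / s := by
      field_simp
      rw [hsq]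
      ring
    rw [key]
    exact div_pos (by nlinarith) hs
  refine strictMonoOn_of_deriv_pos (convex_Ioi 0) ?_ ?_
  · intro x hx
    obtain ⟨d, -, h⟩ := hderiv x hx
    exact h.continuousAt.continuousWithinAt
  · intro x hx
    rw [interior_Ioi] at hx
    obtain ⟨d, hd, h⟩ := hderiv x hx
    rwa [h.deriv]

/-- For N > 0, R > 0 with R·ln 2 ≥ (1/2)·ln N, the decoding error
probability δ(γ) = Q(ζ(γ)) is strictly decreasing on (0,∞), and equivalently the
effective throughput η(γ) = N·R·(1 − δ(γ)) is strictly increasing on (0,∞). -/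
theorem stmt_11 (N R : ℝ) (hN : N > 0) (hR : R > 0)
    (hRN : R * Real.log 2 ≥ (1 / 2) * Real.log N) :
    let ζ : ℝ → ℝ := fun γ =>
      Real.sqrt N * (1 + γ) * (Real.log (1 + γ) + (1 / 2) * Real.log N - R * Real.log 2) /
        Real.sqrt (γ * (γ + 2))
    let δ : ℝ → ℝ := fun γ => gaussQ (ζ γ)
    StrictAntiOn δ (Set.Ioi 0) ∧
    StrictMonoOn (fun γ => N * R * (1 - δ γ)) (Set.Ioi 0) := by
  intro ζ δ
  have hζ : StrictMonoOn ζ (Set.Ioi 0) := by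
    intro x hx y hy hxy
    have h := mul_lt_mul_of_pos_left (strictMonoOn_mul_log_sub_div_sqrt
      (sub_nonneg.mpr hRN) hx hy hxy) (Real.sqrt_pos.mpr hN)
    simp only [ζ]
    convert h using 1 <;> ring
  have hδ : StrictAntiOn δ (Set.Ioi 0) := fun x hx y hy hxy => gaussQ_strictAnti (hζ hx hy hxy)
  refine ⟨hδ, fun x hx y hy hxy => ?_⟩
  exact mul_lt_mul_of_pos_left (sub_lt_sub_left (hδ hx hy hxy) 1) (mul_pos hN hR)
end

section
/- Let ε > 0 and N > 0, and let γ* > 0 be the unique positive solution of N·(ln(1+γ) − γ/(1+γ)) = 2ε². Then γ* satisfies N·(γ*)²/(2(1+γ*)²) < 2ε², equivalently √N·γ*/(1+γ*) < 2ε. -/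
/-- The quadratic lower estimate for `log (1 + x) - x / (1 + x)` on the positive reals. -/
theorem sq_div_lt_log_one_add_sub {x : ℝ} (hx : 0 < x) :
    x ^ 2 / (2 * (1 + x) ^ 2) < Real.log (1 + x) - x / (1 + x) := by
  have hlog := Real.le_log_one_add_of_nonneg hx.le
  have hrat : x ^ 2 / (2 * (1 + x) ^ 2) + x / (1 + x) < 2 * x / (x + 2) := by
    rw [← sub_pos]
    have h : 2 * x / (x + 2) - (x ^ 2 / (2 * (1 + x) ^ 2) + x / (1 + x)) =
        x ^ 3 / (2 * (1 + x) ^ 2 * (x + 2)) := by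
      field_simp
      ring
    rw [h]
    positivity
  linarith

/-- For ε > 0, N > 0, if γ* > 0 solves the exact covertness equation
N·(ln(1+γ*) − γ*/(1+γ*)) = 2ε², then N·(γ*)²/(2(1+γ*)²) < 2ε², equivalently
√N·γ*/(1+γ*) < 2ε. -/
theorem stmt_18 (ε N γs : ℝ) (hε : ε > 0) (hN : N > 0) (hγs : γs > 0)
    (hexact : N * (Real.log (1 + γs) - γs / (1 + γs)) = 2 * ε ^ 2) :
    N * γs ^ 2 / (2 * (1 + γs) ^ 2) < 2 * ε ^ 2 ∧
    Real.sqrt N * γs / (1 + γs) < 2 * ε := by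
  have hquad : N * γs ^ 2 / (2 * (1 + γs) ^ 2) < 2 * ε ^ 2 := by
    rw [← hexact, mul_div_assoc]
    exact mul_lt_mul_of_pos_left (sq_div_lt_log_one_add_sub hγs) hN
  refine ⟨hquad, lt_of_pow_lt_pow_left₀ 2 (by positivity) ?_⟩
  have hsq : (Real.sqrt N * γs / (1 + γs)) ^ 2 =
      2 * (N * γs ^ 2 / (2 * (1 + γs) ^ 2)) := by
    rw [div_pow, mul_pow, Real.sq_sqrt hN.le]
    field_simp
  rw [hsq]
  linarith
end
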